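/- arXiv:2212.11518 — 8 statements merged into one kernel-verified Lean document; each statement's English description precedes it below -/
import Mathlib

section
/- Let κ, q, c, η, T be real numbers with κ > 0, q > 0, c > 0, η ≥ q², T > 0, set Δ = (κ+q)² + η − q² and define Q : ℝ → ℝ by Q(t) = −(1/2)[κ + q − √Δ · ( √Δ · sinh(√Δ (T−t)) + (κ+q+c) · cosh(√Δ (T−t)) ) / ( √Δ · cosh(√Δ (T−t)) + (κ+q+c) · sinh(√Δ (T−t)) )]. Then Q(T) = c/2 and, for every t ≤ T, Q is differentiable at t with Q′(t) = 2(κ+q) Q(t) + 2 Q(t)² − (1/2)(η − q²). -/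
/-- The explicit Riccati function of the systemic risk LQ McKean-Vlasov control problem. -/
noncomputable def Qsys (κ q c η T : ℝ) (t : ℝ) : ℝ :=
  -(1/2) * (κ + q - Real.sqrt ((κ + q)^2 + η - q^2) *
    (Real.sqrt ((κ + q)^2 + η - q^2) * Real.sinh (Real.sqrt ((κ + q)^2 + η - q^2) * (T - t))
      + (κ + q + c) * Real.cosh (Real.sqrt ((κ + q)^2 + η - q^2) * (T - t))) /
    (Real.sqrt ((κ + q)^2 + η - q^2) * Real.cosh (Real.sqrt ((κ + q)^2 + η - q^2) * (T - t))
      + (κ + q + c) * Real.sinh (Real.sqrt ((κ + q)^2 + η - q^2) * (T - t))))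

theorem stmt0 (κ q c η T : ℝ) (hκ : 0 < κ) (hq : 0 < q) (hc : 0 < c)
    (hη : q^2 ≤ η) (hT : 0 < T) :
    Qsys κ q c η T T = c / 2 ∧
    ∀ t : ℝ, t ≤ T →
      HasDerivAt (Qsys κ q c η T)
        (2 * (κ + q) * Qsys κ q c η T t + 2 * (Qsys κ q c η T t)^2 - (1/2) * (η - q^2)) t := by
  set s := Real.sqrt ((κ + q)^2 + η - q^2) with hs
  have hΔ : 0 < (κ + q)^2 + η - q^2 := by
    have : 0 < (κ + q)^2 := by positivity
    linarith
  have hs0 : 0 < s := Real.sqrt_pos.2 hΔ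
  have hss : s^2 = (κ + q)^2 + η - q^2 := Real.sq_sqrt hΔ.le
  refine ⟨?_, fun t ht => ?_⟩
  · simp only [Qsys, ← hs, sub_self, mul_zero, Real.sinh_zero, Real.cosh_zero]
    field_simp
    ring
  · have hsinh : HasDerivAt (fun x => Real.sinh (s * (T - x)))
        (Real.cosh (s * (T - t)) * (s * -1)) t :=
      (((hasDerivAt_id t).const_sub T).const_mul s).sinh
    have hcosh : HasDerivAt (fun x => Real.cosh (s * (T - x)))
        (Real.sinh (s * (T - t)) * (s * -1)) t :=
      (((hasDerivAt_id t).const_sub T).const_mul s).cosh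
    have hD : 0 < s * Real.cosh (s * (T - t)) + (κ + q + c) * Real.sinh (s * (T - t)) := by
      have h1 : 0 ≤ Real.sinh (s * (T - t)) :=
        Real.sinh_nonneg_iff.2 (mul_nonneg hs0.le (sub_nonneg.2 ht))
      have h2 := Real.cosh_pos (s * (T - t))
      positivity
    have hQ := ((((((hsinh.const_mul s).add (hcosh.const_mul (κ + q + c))).const_mul s).div
      ((hcosh.const_mul s).add (hsinh.const_mul (κ + q + c))) hD.ne').const_sub
        (κ + q)).const_mul (-(1/2)))
    refine hQ.congr_deriv ?_
    have hη' : η = s^2 - (κ + q)^2 + q^2 := by linarith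
    simp only [Qsys, ← hs, Pi.add_apply]
    clear_value s
    subst hη'
    generalize Real.sinh (s * (T - t)) = u at *
    generalize Real.cosh (s * (T - t)) = v at *
    have hD' := hD.ne'
    field_simp
    ring
end

section
/- Let κ, q, c, η, T be real numbers with κ > 0, q > 0, c > 0, η ≥ q², T > 0, set Δ = (κ+q)² + η − q² and let Q : [0,T] → ℝ be given by Q(t) = −(1/2)[κ + q − √Δ ( √Δ sinh(√Δ(T−t)) + (κ+q+c) cosh(√Δ(T−t)) ) / ( √Δ cosh(√Δ(T−t)) + (κ+q+c) sinh(√Δ(T−t)) )]. If P : [0,T] → ℝ is continuous, satisfies P(T) = c/2, and is differentiable on [0,T] with P′(t) = 2(κ+q) P(t) + 2 P(t)² − (1/2)(η − q²) for all t ∈ [0,T], then P(t) = Q(t) for every t ∈ [0,T]. -/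
/-- Two solutions on `[0, T]` of an autonomous scalar Riccati equation which agree at `T` are equal. -/
theorem riccati_terminal_unique {α β γ T : ℝ} {f g : ℝ → ℝ}
    (hf : ∀ t ∈ Set.Icc (0 : ℝ) T,
      HasDerivWithinAt f (α * f t + β * f t ^ 2 + γ) (Set.Icc 0 T) t)
    (hg : ∀ t ∈ Set.Icc (0 : ℝ) T,
      HasDerivWithinAt g (α * g t + β * g t ^ 2 + γ) (Set.Icc 0 T) t)
    (hT : f T = g T) : Set.EqOn f g (Set.Icc 0 T) := by
  have hfc : ContinuousOn f (Set.Icc 0 T) := fun t ht => (hf t ht).continuousWithinAt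
  have hgc : ContinuousOn g (Set.Icc 0 T) := fun t ht => (hg t ht).continuousWithinAt
  obtain ⟨A, hA⟩ := isCompact_Icc.exists_bound_of_continuousOn hfc
  obtain ⟨B, hB⟩ := isCompact_Icc.exists_bound_of_continuousOn hgc
  have hnhds : ∀ t ∈ Set.Ioc (0 : ℝ) T, Set.Icc 0 T ∈ nhdsWithin t (Set.Iic t) := fun t ht =>
    Filter.mem_of_superset (Icc_mem_nhdsLE ht.1) (Set.Icc_subset_Icc_right ht.2)
  refine ODE_solution_unique_of_mem_Icc_left
    (v := fun _ x => α * x + β * x ^ 2 + γ) (s := fun _ => Metric.closedBall 0 (max A B))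
    (K := Real.toNNReal (|α| + |β| * (max A B + max A B))) ?_ hfc
    (fun t ht => (hf t (Set.Ioc_subset_Icc_self ht)).mono_of_mem_nhdsWithin (hnhds t ht))
    (fun t ht => mem_closedBall_zero_iff.2
      ((hA t (Set.Ioc_subset_Icc_self ht)).trans (le_max_left _ _))) hgc
    (fun t ht => (hg t (Set.Ioc_subset_Icc_self ht)).mono_of_mem_nhdsWithin (hnhds t ht))
    (fun t ht => mem_closedBall_zero_iff.2
      ((hB t (Set.Ioc_subset_Icc_self ht)).trans (le_max_right _ _))) hT
  refine fun t _ => LipschitzOnWith.of_dist_le_mul fun x hx y hy => ?_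
  rw [mem_closedBall_zero_iff, Real.norm_eq_abs] at hx hy
  have hfactor : α * x + β * x ^ 2 + γ - (α * y + β * y ^ 2 + γ)
      = (α + β * (x + y)) * (x - y) := by ring
  rw [Real.dist_eq, Real.dist_eq, hfactor, abs_mul]
  refine mul_le_mul_of_nonneg_right (le_trans ?_ (Real.le_coe_toNNReal _)) (abs_nonneg _)
  calc |α + β * (x + y)| ≤ |α| + |β| * |x + y| := by
        rw [← abs_mul]
        exact abs_add_le _ _
    _ ≤ |α| + |β| * (max A B + max A B) := by
        gcongr
        exact (abs_add_le _ _).trans (add_le_add hx hy)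

/-- The explicit function `Qsys` solves the Riccati equation wherever its denominator is nonzero. -/
theorem hasDerivAt_Qsys {κ q c η T t : ℝ} (hΔ : 0 ≤ (κ + q) ^ 2 + η - q ^ 2)
    (hD : √((κ + q) ^ 2 + η - q ^ 2) * Real.cosh (√((κ + q) ^ 2 + η - q ^ 2) * (T - t))
      + (κ + q + c) * Real.sinh (√((κ + q) ^ 2 + η - q ^ 2) * (T - t)) ≠ 0) :
    HasDerivAt (Qsys κ q c η T)
      (2 * (κ + q) * Qsys κ q c η T t + 2 * Qsys κ q c η T t ^ 2 - (1 / 2) * (η - q ^ 2)) t := by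
  have hs := Real.sq_sqrt hΔ
  unfold Qsys
  set s := √((κ + q) ^ 2 + η - q ^ 2)
  have hη : η - q ^ 2 = s ^ 2 - (κ + q) ^ 2 := by rw [hs]; ring
  have hlin : HasDerivAt (fun t => s * (T - t)) (s * -1) t :=
    ((hasDerivAt_id t).const_sub T).const_mul s
  have hN := (hlin.sinh.const_mul s).add (hlin.cosh.const_mul (κ + q + c))
  have hDen := (hlin.cosh.const_mul s).add (hlin.sinh.const_mul (κ + q + c))
  refine ((((hN.const_mul s).div hDen hD).const_sub (κ + q)).const_mul (-(1 / 2))).congr_deriv ?_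
  rw [hη]
  simp only [Pi.add_apply]
  field_simp
  ring

theorem stmt2 (κ q c η T : ℝ) (hκ : 0 < κ) (hq : 0 < q) (hc : 0 < c)
    (hη : q^2 ≤ η) (hT : 0 < T) (P : ℝ → ℝ)
    (hPcont : ContinuousOn P (Set.Icc 0 T))
    (hPT : P T = c / 2)
    (hP' : ∀ t ∈ Set.Icc (0:ℝ) T,
      HasDerivWithinAt P
        (2 * (κ + q) * P t + 2 * (P t)^2 - (1/2) * (η - q^2)) (Set.Icc 0 T) t) :
    ∀ t ∈ Set.Icc (0:ℝ) T, P t = Qsys κ q c η T t := by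
  have hΔ : 0 < (κ + q) ^ 2 + η - q ^ 2 := by nlinarith [sq_pos_of_pos (add_pos hκ hq)]
  have hs := Real.sqrt_pos.2 hΔ
  have hQT : Qsys κ q c η T T = c / 2 := by
    simp only [Qsys, sub_self, mul_zero, Real.sinh_zero, Real.cosh_zero, mul_one, zero_add,
      add_zero]
    rw [mul_div_cancel_left₀ _ hs.ne']
    ring
  refine riccati_terminal_unique (α := 2 * (κ + q)) (β := 2) (γ := -((1 / 2) * (η - q ^ 2)))
    (fun t ht => (hP' t ht).congr_deriv (by ring))
    (fun t ht => ((hasDerivAt_Qsys hΔ.le ?_).congr_deriv (by ring)).hasDerivWithinAt)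
    (hPT.trans hQT.symm)
  have hsinh := Real.sinh_nonneg_iff.2 (mul_nonneg hs.le (sub_nonneg.2 ht.2))
  have hcosh := Real.cosh_pos (√((κ + q) ^ 2 + η - q ^ 2) * (T - t))
  positivity
end

section
/- Let κ, q, c, η, T be real numbers with κ > 0, q > 0, c > 0, η ≥ q², T > 0, set Δ = (κ+q)² + η − q² and define Q(t) = −(1/2)[κ + q − √Δ ( √Δ sinh(√Δ(T−t)) + (κ+q+c) cosh(√Δ(T−t)) ) / ( √Δ cosh(√Δ(T−t)) + (κ+q+c) sinh(√Δ(T−t)) )]. Then Q(t) > 0 for every t ∈ [0,T]. -/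
theorem stmt3 (κ q c η T : ℝ) (hκ : 0 < κ) (hq : 0 < q) (hc : 0 < c)
    (hη : q^2 ≤ η) (hT : 0 < T) :
    ∀ t ∈ Set.Icc (0:ℝ) T, 0 < Qsys κ q c η T t := by
  rintro t ⟨-, htT⟩
  unfold Qsys
  have hle : κ + q ≤ Real.sqrt ((κ + q)^2 + η - q^2) :=
    Real.le_sqrt_of_sq_le (by linarith)
  generalize Real.sqrt ((κ + q)^2 + η - q^2) = S at hle ⊢
  have ha : 0 < κ + q := by linarith
  generalize κ + q = a at ha hle ⊢
  have hS : 0 < S := ha.trans_le hle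
  have hsinh : 0 ≤ Real.sinh (S * (T - t)) :=
    Real.sinh_nonneg_iff.mpr (mul_nonneg hS.le (sub_nonneg.mpr htT))
  have hlt : Real.sinh (S * (T - t)) < Real.cosh (S * (T - t)) := Real.sinh_lt_cosh _
  generalize Real.sinh (S * (T - t)) = s at hsinh hlt ⊢
  generalize Real.cosh (S * (T - t)) = C at hlt ⊢
  have hC : 0 < C := hsinh.trans_lt hlt
  have hD : 0 < S * C + (a + c) * s := by positivity
  have hcross : 0 < c * (S * C - a * s) :=
    mul_pos hc (by nlinarith [mul_pos hS (sub_pos.mpr hlt), mul_nonneg (sub_nonneg.mpr hle) hsinh])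
  have hsq : 0 ≤ (S - a) * (S + a) * s :=
    mul_nonneg (mul_nonneg (sub_nonneg.mpr hle) (by positivity)) hsinh
  have key : a < S * (S * s + (a + c) * C) / (S * C + (a + c) * s) := by
    rw [lt_div_iff₀ hD]
    linarith
  linarith
end

section
/- Let κ, q, c, η, T be real numbers with κ > 0, q > 0, c > 0, η ≥ q², T > 0, set Δ = (κ+q)² + η − q² and define Q(t) = −(1/2)[κ + q − √Δ ( √Δ sinh(√Δ(T−t)) + (κ+q+c) cosh(√Δ(T−t)) ) / ( √Δ cosh(√Δ(T−t)) + (κ+q+c) sinh(√Δ(T−t)) )]. Then for every t ∈ [0,T]: ∫ₜᵀ Q(s) ds = (1/2) · log[ cosh(√Δ(T−t)) + ((κ+q+c)/√Δ) · sinh(√Δ(T−t)) ] − (1/2)(κ+q)(T−t). -/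
theorem cosh_add_mul_sinh_pos {b x : ℝ} (hb : 0 ≤ b) (hx : 0 ≤ x) :
    0 < Real.cosh x + b * Real.sinh x :=
  add_pos_of_pos_of_nonneg (Real.cosh_pos x) (mul_nonneg hb (Real.sinh_nonneg_iff.2 hx))

theorem hasDerivAt_log_cosh_add_mul_sinh {r b T s : ℝ}
    (h : Real.cosh (r * (T - s)) + b * Real.sinh (r * (T - s)) ≠ 0) :
    HasDerivAt
      (fun s => Real.log (Real.cosh (r * (T - s)) + b * Real.sinh (r * (T - s))))
      (-r * (Real.sinh (r * (T - s)) + b * Real.cosh (r * (T - s))) /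
        (Real.cosh (r * (T - s)) + b * Real.sinh (r * (T - s)))) s := by
  have hlin : HasDerivAt (fun s => r * (T - s)) (-r) s := by
    simpa using ((hasDerivAt_id s).const_sub T).const_mul r
  have hd := (hlin.cosh.add (hlin.sinh.const_mul b)).log h
  refine hd.congr_deriv ?_
  simp only [Pi.add_apply]
  ring

theorem stmt4 (κ q c η T : ℝ) (hκ : 0 < κ) (hq : 0 < q) (hc : 0 < c)
    (hη : q^2 ≤ η) (hT : 0 < T) :
    ∀ t ∈ Set.Icc (0:ℝ) T,
      (∫ s in t..T, Qsys κ q c η T s) =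
        (1/2) * Real.log (Real.cosh (Real.sqrt ((κ + q)^2 + η - q^2) * (T - t))
            + ((κ + q + c) / Real.sqrt ((κ + q)^2 + η - q^2))
              * Real.sinh (Real.sqrt ((κ + q)^2 + η - q^2) * (T - t)))
          - (1/2) * (κ + q) * (T - t) := by
  intro t ht
  have hr : 0 < Real.sqrt ((κ + q)^2 + η - q^2) :=
    Real.sqrt_pos.2 (by nlinarith [pow_pos (add_pos hκ hq) 2])
  unfold Qsys
  generalize Real.sqrt ((κ + q)^2 + η - q^2) = r at hr ⊢
  have ha : 0 < κ + q + c := by positivity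
  generalize κ + q + c = a at ha ⊢
  have hpos : ∀ s ∈ Set.uIcc t T,
      0 < Real.cosh (r * (T - s)) + a / r * Real.sinh (r * (T - s)) := by
    intro s hs
    rw [Set.uIcc_of_le ht.2] at hs
    exact cosh_add_mul_sinh_pos (div_pos ha hr).le (mul_nonneg hr.le (sub_nonneg.2 hs.2))
  have hden : ∀ s, r * Real.cosh (r * (T - s)) + a * Real.sinh (r * (T - s)) =
      r * (Real.cosh (r * (T - s)) + a / r * Real.sinh (r * (T - s))) := by
    intro s
    field_simp
  have hden_ne : ∀ s ∈ Set.uIcc t T,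
      r * Real.cosh (r * (T - s)) + a * Real.sinh (r * (T - s)) ≠ 0 := by
    intro s hs
    rw [hden]
    exact (mul_pos hr (hpos s hs)).ne'
  rw [intervalIntegral.integral_eq_sub_of_hasDerivAt (f := fun s =>
    -(1/2) * Real.log (Real.cosh (r * (T - s)) + a / r * Real.sinh (r * (T - s)))
      - (1/2) * (κ + q) * s)]
  · simp
    ring
  · intro s hs
    have hd := ((hasDerivAt_log_cosh_add_mul_sinh (hpos s hs).ne').const_mul (-(1/2))).sub
      ((hasDerivAt_id s).const_mul ((1/2) * (κ + q)))
    refine hd.congr_deriv ?_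
    have hne := (hpos s hs).ne'
    rw [hden]
    generalize hD : Real.cosh (r * (T - s)) + a / r * Real.sinh (r * (T - s)) = D at hne ⊢
    field_simp
    ring
  · apply ContinuousOn.intervalIntegrable
    refine continuousOn_const.mul (continuousOn_const.sub (ContinuousOn.div ?_ ?_ hden_ne))
    · fun_prop
    · fun_prop
end

section
/- Let β ∈ ℝ, ν > 0, λ > 0, T > 0, set R = β²/ν² and define w(t,m,θ) = λ e^{−R(T−t)} θ − m − (1/(4λ))(e^{R(T−t)} − 1). Then w(T,m,θ) = λθ − m for all m, θ, and for every t ∈ [0,T], every m ∈ ℝ and every θ ≥ 0: (i) the infimum over (φ,ψ) ∈ ℝ² of β ψ · ∂_m w(t,m,θ) + (2βφθ + ν²(φ²θ + ψ²)) · ∂_θ w(t,m,θ) equals −R θ λ e^{−R(T−t)} − (R/(4λ)) e^{R(T−t)}; and (ii) ∂ₜ w(t,m,θ) plus this infimum equals 0. -/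
/-- Candidate value function of the reduced (mean, variance) problem for
the Markowitz mean-variance portfolio selection problem. -/
noncomputable def wMV (β ν lam T : ℝ) (t m θ : ℝ) : ℝ :=
  lam * Real.exp (-(β^2 / ν^2) * (T - t)) * θ - m
    - (1 / (4 * lam)) * (Real.exp ((β^2 / ν^2) * (T - t)) - 1)

theorem hasDerivAt_wMV_mean (β ν lam T t m θ : ℝ) :
    HasDerivAt (fun m' => wMV β ν lam T t m' θ) (-1) m := by
  unfold wMV
  exact ((hasDerivAt_id' m).const_sub _).sub_const _

theorem hasDerivAt_wMV_variance (β ν lam T t m θ : ℝ) :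
    HasDerivAt (fun θ' => wMV β ν lam T t m θ')
      (lam * Real.exp (-(β^2 / ν^2) * (T - t))) θ := by
  unfold wMV
  exact ((((hasDerivAt_id' θ).const_mul _).sub_const _).sub_const _).congr_deriv (mul_one _)

theorem hasDerivAt_wMV_time (β ν lam T t m θ : ℝ) :
    HasDerivAt (fun t' => wMV β ν lam T t' m θ)
      (lam * (β^2 / ν^2) * Real.exp (-(β^2 / ν^2) * (T - t)) * θ
        + (β^2 / ν^2) / (4 * lam) * Real.exp ((β^2 / ν^2) * (T - t))) t := by
  unfold wMV
  have hexp (c : ℝ) : HasDerivAt (fun t' => Real.exp (c * (T - t')))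
      (Real.exp (c * (T - t)) * (c * (-1))) t :=
    (((hasDerivAt_id' t).const_sub T).const_mul c).exp
  refine (((((hexp (-(β^2 / ν^2))).const_mul lam).mul_const θ).sub_const m).sub
    (((hexp (β^2 / ν^2)).sub_const 1).const_mul (1 / (4 * lam)))).congr_deriv ?_
  ring

/-- Completing the square in the Hamiltonian; `E` and `F` stand for the two reciprocal
exponentials. -/
theorem hamiltonian_eq_add_sq {β ν lam E F : ℝ} (hν : ν ≠ 0) (hlam : lam ≠ 0)
    (hEF : E * F = 1) (θ φ ψ : ℝ) :
    β * ψ * (-1) + (2 * β * φ * θ + ν^2 * (φ^2 * θ + ψ^2)) * (lam * E)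
      = (-(β^2 / ν^2) * θ * lam * E - ((β^2 / ν^2) / (4 * lam)) * F)
        + lam * E * ν^2 * (θ * (φ + β / ν^2)^2 + (ψ - β * F / (2 * ν^2 * lam))^2) := by
  have hE : E ≠ 0 := left_ne_zero_of_mul_eq_one hEF
  obtain rfl : F = E⁻¹ := eq_inv_of_mul_eq_one_right hEF
  field_simp
  ring

theorem stmt10 (β ν lam T : ℝ) (hν : 0 < ν) (hlam : 0 < lam) (hT : 0 < T) :
    (∀ m θ : ℝ, wMV β ν lam T T m θ = lam * θ - m) ∧
    ∀ t ∈ Set.Icc (0:ℝ) T, ∀ m : ℝ, ∀ θ : ℝ, 0 ≤ θ →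
      (IsLeast
        (Set.range (fun p : ℝ × ℝ =>
          β * p.2 * deriv (fun m' => wMV β ν lam T t m' θ) m
            + (2 * β * p.1 * θ + ν^2 * (p.1^2 * θ + p.2^2))
              * deriv (fun θ' => wMV β ν lam T t m θ') θ))
        (-(β^2 / ν^2) * θ * lam * Real.exp (-(β^2 / ν^2) * (T - t))
          - ((β^2 / ν^2) / (4 * lam)) * Real.exp ((β^2 / ν^2) * (T - t)))) ∧
      (deriv (fun t' => wMV β ν lam T t' m θ) t
        + (-(β^2 / ν^2) * θ * lam * Real.exp (-(β^2 / ν^2) * (T - t))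
            - ((β^2 / ν^2) / (4 * lam)) * Real.exp ((β^2 / ν^2) * (T - t))) = 0) := by
  refine ⟨fun m θ => by simp [wMV], fun t _ m θ hθ => ?_⟩
  rw [(hasDerivAt_wMV_mean β ν lam T t m θ).deriv,
    (hasDerivAt_wMV_variance β ν lam T t m θ).deriv,
    (hasDerivAt_wMV_time β ν lam T t m θ).deriv]
  have hE := Real.exp_pos (-(β^2 / ν^2) * (T - t))
  have hEF : Real.exp (-(β^2 / ν^2) * (T - t)) * Real.exp ((β^2 / ν^2) * (T - t)) = 1 := by
    rw [← Real.exp_add, neg_mul, neg_add_cancel, Real.exp_zero]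
  refine ⟨⟨⟨(-(β / ν^2), β * Real.exp ((β^2 / ν^2) * (T - t)) / (2 * ν^2 * lam)), ?_⟩, ?_⟩,
    by ring⟩
  · dsimp only
    rw [hamiltonian_eq_add_sq hν.ne' hlam.ne' hEF]
    ring
  · rintro _ ⟨⟨φ, ψ⟩, rfl⟩
    dsimp only
    rw [hamiltonian_eq_add_sq hν.ne' hlam.ne' hEF]
    exact le_add_of_nonneg_right (by positivity)
end

section
/- Let β ∈ ℝ, ν > 0, λ > 0, T > 0, R = β²/ν², t ∈ [0,T] and θ > 0. Then the function (φ,ψ) ↦ −β ψ + (2βφθ + ν²(φ²θ + ψ²)) · λ e^{−R(T−t)} on ℝ² has the unique minimizer (φ*, ψ*) = (−β/ν², β e^{R(T−t)}/(2λν²)). Consequently, the corresponding affine feedback control x ↦ φ*(x − m) + ψ* equals x ↦ −(β/ν²)(x − m − e^{R(T−t)}/(2λ)) for every m ∈ ℝ. -/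
/-- Completing the square in the quadratic Hamiltonian of the Markowitz problem. -/
theorem markowitz_hamiltonian_eq (β θ φ ψ : ℝ) {ν lam E : ℝ} (hν : ν ≠ 0) (hlam : lam ≠ 0)
    (hE : E ≠ 0) :
    -β * ψ + (2 * β * φ * θ + ν^2 * (φ^2 * θ + ψ^2)) * (lam * E⁻¹)
      = -β * (β * E / (2 * lam * ν^2))
          + (2 * β * (-β / ν^2) * θ
              + ν^2 * ((-β / ν^2)^2 * θ + (β * E / (2 * lam * ν^2))^2)) * (lam * E⁻¹)
        + ν^2 * (lam * E⁻¹)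
            * (θ * (φ - -β / ν^2)^2 + (ψ - β * E / (2 * lam * ν^2))^2) := by
  field_simp
  ring

theorem stmt11 (β ν lam T t θ : ℝ) (hν : 0 < ν) (hlam : 0 < lam) (hT : 0 < T)
    (ht : t ∈ Set.Icc (0:ℝ) T) (hθ : 0 < θ) :
    (∀ φ ψ : ℝ,
      -β * (β * Real.exp ((β^2 / ν^2) * (T - t)) / (2 * lam * ν^2))
          + (2 * β * (-β / ν^2) * θ
              + ν^2 * ((-β / ν^2)^2 * θ
                + (β * Real.exp ((β^2 / ν^2) * (T - t)) / (2 * lam * ν^2))^2))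
            * (lam * Real.exp (-(β^2 / ν^2) * (T - t)))
        ≤ -β * ψ + (2 * β * φ * θ + ν^2 * (φ^2 * θ + ψ^2))
            * (lam * Real.exp (-(β^2 / ν^2) * (T - t)))) ∧
    (∀ φ ψ : ℝ,
      (∀ φ' ψ' : ℝ,
        -β * ψ + (2 * β * φ * θ + ν^2 * (φ^2 * θ + ψ^2))
            * (lam * Real.exp (-(β^2 / ν^2) * (T - t)))
          ≤ -β * ψ' + (2 * β * φ' * θ + ν^2 * (φ'^2 * θ + ψ'^2))
              * (lam * Real.exp (-(β^2 / ν^2) * (T - t)))) →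
      φ = -β / ν^2 ∧ ψ = β * Real.exp ((β^2 / ν^2) * (T - t)) / (2 * lam * ν^2)) ∧
    (∀ m x : ℝ,
      (-β / ν^2) * (x - m) + β * Real.exp ((β^2 / ν^2) * (T - t)) / (2 * lam * ν^2)
        = -(β / ν^2) * (x - m - Real.exp ((β^2 / ν^2) * (T - t)) / (2 * lam))) := by
  have hF : Real.exp (-(β^2 / ν^2) * (T - t)) = (Real.exp ((β^2 / ν^2) * (T - t)))⁻¹ := by
    rw [neg_mul, Real.exp_neg]
  rw [hF]
  have hE : 0 < Real.exp ((β^2 / ν^2) * (T - t)) := Real.exp_pos _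
  generalize Real.exp ((β^2 / ν^2) * (T - t)) = E at hE
  have key (φ ψ : ℝ) := markowitz_hamiltonian_eq β θ φ ψ hν.ne' hlam.ne' hE.ne'
  have hc : 0 < ν^2 * (lam * E⁻¹) := by positivity
  refine ⟨fun φ ψ => ?_, fun φ ψ h => ?_, fun m x => ?_⟩
  · rw [key φ ψ]
    exact le_add_of_nonneg_right (by positivity)
  · have h' := h (-β / ν^2) (β * E / (2 * lam * ν^2))
    rw [key φ ψ, add_le_iff_nonpos_right] at h'
    have hsum := nonpos_of_mul_nonpos_right h' hc
    have hφ : 0 ≤ θ * (φ - -β / ν^2)^2 := by positivity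
    have hψ := sq_nonneg (ψ - β * E / (2 * lam * ν^2))
    constructor
    · have h0 : θ * (φ - -β / ν^2)^2 = 0 := by linarith
      exact sub_eq_zero.mp (pow_eq_zero_iff two_ne_zero |>.mp
        ((mul_eq_zero.mp h0).resolve_left hθ.ne'))
    · have h0 : (ψ - β * E / (2 * lam * ν^2))^2 = 0 := by linarith
      exact sub_eq_zero.mp (pow_eq_zero_iff two_ne_zero |>.mp h0)
  · field_simp
    ring
end

section
/- Let β ∈ ℝ, ν > 0, λ > 0, T > 0, R = β²/ν², and define w(t,m,θ) = λ e^{−R(T−t)} θ − m − (1/(4λ))(e^{R(T−t)} − 1). Let φ, ψ : [0,T] → ℝ be continuous, m₀ ∈ ℝ, θ₀ ≥ 0, and let m, θ : [0,T] → ℝ be differentiable with m(0) = m₀, θ(0) = θ₀, m′(t) = β ψ(t) and θ′(t) = 2βφ(t)θ(t) + ν²(φ(t)²θ(t) + ψ(t)²) for all t ∈ [0,T]. Then λ θ(T) − m(T) ≥ w(0, m₀, θ₀) = λ e^{−RT} θ₀ − m₀ − (1/(4λ))(e^{RT} − 1). -/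
/-- A differentiable supersolution of the linear equation `f' = a f` on `[0, T]`, with `a`
continuous and `f 0 ≥ 0`, stays nonnegative. -/
theorem nonneg_of_mul_le_deriv {a f f' : ℝ → ℝ} {T : ℝ}
    (ha : ContinuousOn a (Set.Icc 0 T)) (hf₀ : 0 ≤ f 0)
    (hf : ∀ t ∈ Set.Icc (0 : ℝ) T, HasDerivAt f (f' t) t)
    (hle : ∀ t ∈ Set.Icc (0 : ℝ) T, a t * f t ≤ f' t) :
    ∀ t ∈ Set.Icc (0 : ℝ) T, 0 ≤ f t := by
  obtain ⟨K, hK⟩ := isCompact_Icc.bddAbove_image ha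
  have barrier : ∀ ε > 0, ∀ t ∈ Set.Icc (0 : ℝ) T, -f t ≤ ε * Real.exp ((K + 1) * t) := by
    intro ε hε
    refine image_le_of_deriv_right_lt_deriv_boundary (f' := fun t => -f' t)
      (B' := fun t => ε * (Real.exp ((K + 1) * t) * (K + 1)))
      (fun t ht => (hf t ht).continuousAt.neg.continuousWithinAt)
      (fun t ht => (hf t (Set.Ico_subset_Icc_self ht)).neg.hasDerivWithinAt)
      (by simp; linarith) (fun t => ?_) (fun t ht heq => ?_)
    · simpa using ((((hasDerivAt_id t).const_mul (K + 1)).exp).const_mul ε)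
    · have ht' := Set.Ico_subset_Icc_self ht
      have haK : a t ≤ K := hK (Set.mem_image_of_mem a ht')
      have hpos : 0 < ε * Real.exp ((K + 1) * t) := by positivity
      have hle' := hle t ht'
      have hf_eq : f t = -(ε * Real.exp ((K + 1) * t)) := by
        rw [← heq, Pi.neg_apply, neg_neg]
      rw [hf_eq] at hle'
      nlinarith [mul_le_mul_of_nonneg_right haK hpos.le]
  intro t ht
  refine neg_nonpos.mp (le_of_forall_pos_le_add fun ε hε => ?_)
  have h := barrier (ε * Real.exp (-((K + 1) * t))) (by positivity) t ht
  rwa [mul_assoc, ← Real.exp_add, neg_add_cancel, Real.exp_zero, mul_one, ← zero_add ε] at h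

/-- The Hamiltonian of the reduced control problem is nonnegative, by completing the squares
in the two controls. -/
theorem reduced_hamiltonian_nonneg {β ν lam E θ : ℝ} (φ ψ : ℝ)
    (hν : 0 < ν) (hlam : 0 < lam) (hE : 0 < E) (hθ : 0 ≤ θ) :
    0 ≤ lam * (E * (β ^ 2 / ν ^ 2) * θ
          + E * (2 * β * φ * θ + ν ^ 2 * (φ ^ 2 * θ + ψ ^ 2)))
        - β * ψ + 1 / (4 * lam) * (E⁻¹ * (β ^ 2 / ν ^ 2)) := by
  have h : lam * (E * (β ^ 2 / ν ^ 2) * θ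
          + E * (2 * β * φ * θ + ν ^ 2 * (φ ^ 2 * θ + ψ ^ 2)))
        - β * ψ + 1 / (4 * lam) * (E⁻¹ * (β ^ 2 / ν ^ 2))
      = lam * E * θ * (ν * φ + β / ν) ^ 2
        + lam * E * (ν * ψ - β / (2 * lam * E * ν)) ^ 2 := by
    field_simp
    ring
  rw [h]
  positivity

theorem stmt12 (β ν lam T : ℝ) (hν : 0 < ν) (hlam : 0 < lam) (hT : 0 < T)
    (φ ψ : ℝ → ℝ)
    (hφ : ContinuousOn φ (Set.Icc 0 T)) (hψ : ContinuousOn ψ (Set.Icc 0 T))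
    (m₀ θ₀ : ℝ) (hθ₀ : 0 ≤ θ₀)
    (m θ : ℝ → ℝ) (hminit : m 0 = m₀) (hθinit : θ 0 = θ₀)
    (hm' : ∀ t ∈ Set.Icc (0:ℝ) T, HasDerivAt m (β * ψ t) t)
    (hθ' : ∀ t ∈ Set.Icc (0:ℝ) T,
      HasDerivAt θ (2 * β * φ t * θ t + ν^2 * ((φ t)^2 * θ t + (ψ t)^2)) t) :
    lam * Real.exp (-(β^2 / ν^2) * T) * θ₀ - m₀
        - (1 / (4 * lam)) * (Real.exp ((β^2 / ν^2) * T) - 1)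
      ≤ lam * θ T - m T := by
  have hθ : ∀ t ∈ Set.Icc (0 : ℝ) T, 0 ≤ θ t := by
    refine nonneg_of_mul_le_deriv (a := fun t => 2 * β * φ t + ν ^ 2 * φ t ^ 2)
      (by fun_prop) (hθinit ▸ hθ₀) hθ' fun t _ => ?_
    nlinarith [mul_nonneg (sq_nonneg ν) (sq_nonneg (ψ t))]
  set R := β ^ 2 / ν ^ 2
  let W : ℝ → ℝ := fun t => lam * (Real.exp (-R * (T - t)) * θ t) - m t
    - 1 / (4 * lam) * (Real.exp (R * (T - t)) - 1)
  have hW : ∀ t ∈ Set.Icc (0 : ℝ) T, HasDerivAt W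
      (lam * (Real.exp (-R * (T - t)) * R * θ t + Real.exp (-R * (T - t)) *
          (2 * β * φ t * θ t + ν ^ 2 * (φ t ^ 2 * θ t + ψ t ^ 2)))
        - β * ψ t + 1 / (4 * lam) * ((Real.exp (-R * (T - t)))⁻¹ * R)) t := by
    intro t ht
    have hexp : ∀ c : ℝ, HasDerivAt (fun s => Real.exp (c * (T - s)))
        (Real.exp (c * (T - t)) * (c * -1)) t := fun c =>
      (((hasDerivAt_id t).const_sub T).const_mul c).exp
    refine HasDerivAt.congr_deriv (((((hexp (-R)).mul (hθ' t ht)).const_mul lam).sub (hm' t ht)).sub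
      (((hexp R).sub_const 1).const_mul (1 / (4 * lam)))) ?_
    rw [← Real.exp_neg, neg_mul, neg_neg]
    ring
  have hmono : MonotoneOn W (Set.Icc 0 T) := by
    refine monotoneOn_of_hasDerivWithinAt_nonneg (convex_Icc 0 T)
      (fun t ht => (hW t ht).continuousAt.continuousWithinAt)
      (fun t ht => (hW t (interior_subset ht)).hasDerivWithinAt) fun t ht => ?_
    exact reduced_hamiltonian_nonneg (φ t) (ψ t) hν hlam (Real.exp_pos _)
      (hθ t (interior_subset ht))
  have h := hmono (Set.left_mem_Icc.mpr hT.le) (Set.right_mem_Icc.mpr hT.le) hT.le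
  simpa [W, hminit, hθinit, mul_assoc] using h
end

section
/- Let β ∈ ℝ, ν > 0, λ > 0, T > 0, R = β²/ν². Let m₀ ∈ ℝ, θ₀ ≥ 0, and let m, θ : [0,T] → ℝ be differentiable with m(0) = m₀, θ(0) = θ₀, m′(t) = β · (β e^{R(T−t)}/(2λν²)) and θ′(t) = −R θ(t) + (R/(4λ²)) e^{2R(T−t)} for all t ∈ [0,T]. Then λ θ(T) − m(T) = λ e^{−RT} θ₀ − m₀ − (1/(4λ))(e^{RT} − 1). -/
theorem eq_of_hasDerivAt_zero_on_Icc {f : ℝ → ℝ} {a b : ℝ} (hab : a ≤ b)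
    (hf : ∀ t ∈ Set.Icc a b, HasDerivAt f 0 t) : f b = f a :=
  constant_of_has_deriv_right_zero (fun t ht => (hf t ht).continuousAt.continuousWithinAt)
    (fun t ht => (hf t (Set.Ico_subset_Icc_self ht)).hasDerivWithinAt) b
    (Set.right_mem_Icc.mpr hab)

theorem stmt13 (β ν lam T : ℝ) (hν : 0 < ν) (hlam : 0 < lam) (hT : 0 < T)
    (m₀ θ₀ : ℝ) (hθ₀ : 0 ≤ θ₀)
    (m θ : ℝ → ℝ) (hminit : m 0 = m₀) (hθinit : θ 0 = θ₀)
    (hm' : ∀ t ∈ Set.Icc (0:ℝ) T,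
      HasDerivAt m (β * (β * Real.exp ((β^2 / ν^2) * (T - t)) / (2 * lam * ν^2))) t)
    (hθ' : ∀ t ∈ Set.Icc (0:ℝ) T,
      HasDerivAt θ (-(β^2 / ν^2) * θ t
        + ((β^2 / ν^2) / (4 * lam^2)) * Real.exp (2 * (β^2 / ν^2) * (T - t))) t) :
    lam * θ T - m T
      = lam * Real.exp (-(β^2 / ν^2) * T) * θ₀ - m₀
          - (1 / (4 * lam)) * (Real.exp ((β^2 / ν^2) * T) - 1) := by
  set R := β ^ 2 / ν ^ 2 with hR
  have hm : m T + Real.exp (R * (T - T)) / (2 * lam)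
      = m 0 + Real.exp (R * (T - 0)) / (2 * lam) := by
    refine eq_of_hasDerivAt_zero_on_Icc
      (f := fun t => m t + Real.exp (R * (T - t)) / (2 * lam)) hT.le fun t ht => ?_
    have hexp := ((((hasDerivAt_id t).const_sub T).const_mul R).exp).div_const (2 * lam)
    refine ((hm' t ht).add hexp).congr_deriv ?_
    simp only [id]
    rw [hR]
    field_simp
    ring
  have hθ : Real.exp (R * T) * θ T + Real.exp (R * (2 * T - T)) / (4 * lam ^ 2)
      = Real.exp (R * 0) * θ 0 + Real.exp (R * (2 * T - 0)) / (4 * lam ^ 2) := by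
    refine eq_of_hasDerivAt_zero_on_Icc
      (f := fun t => Real.exp (R * t) * θ t + Real.exp (R * (2 * T - t)) / (4 * lam ^ 2))
      hT.le fun t ht => ?_
    have hexp := (((hasDerivAt_id t).const_mul R).exp)
    have hexp' :=
      ((((hasDerivAt_id t).const_sub (2 * T)).const_mul R).exp).div_const (4 * lam ^ 2)
    refine ((hexp.mul (hθ' t ht)).add hexp').congr_deriv ?_
    have hsplit : Real.exp (R * (2 * T - t))
        = Real.exp (R * t) * Real.exp (2 * R * (T - t)) := by
      rw [← Real.exp_add]
      ring_nf
    simp only [id]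
    rw [hsplit]
    ring
  have hsq : Real.exp (R * (2 * T)) = Real.exp (R * T) * Real.exp (R * T) := by
    rw [← Real.exp_add]
    ring_nf
  have hT2 : 2 * T - T = T := by ring
  rw [hT2, mul_zero, sub_zero, Real.exp_zero, one_mul, hsq, hθinit] at hθ
  rw [sub_self, mul_zero, sub_zero, Real.exp_zero, hminit] at hm
  have hpos := Real.exp_pos (R * T)
  rw [neg_mul, Real.exp_neg]
  generalize Real.exp (R * T) = E at *
  have hθT : θ T = (θ₀ + E * E / (4 * lam ^ 2) - E / (4 * lam ^ 2)) / E := by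
    rw [eq_div_iff hpos.ne']
    linarith
  have hmT : m T = m₀ + E / (2 * lam) - 1 / (2 * lam) := by linarith
  rw [hθT, hmT]
  field_simp
  ring
end
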